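/- For every N ∈ ℕ there exist K(N) ∈ ℕ and a constant C_N > 0 such that the following holds. Let j ∈ ℤ, A > 0, and let m : ℝ³ → ℂ be a C^{K(N)} symbol supported in { (ξ,η,σ) : |ξ| + |η| + |σ| ≤ 2^{j+5} } satisfying |∂^α_{ξ,η,σ} m(ξ,η,σ)| ≤ A · 2^{-j|α|} for all multi-indices α with |α| ≤ K(N). Let f₁, f₂, f₃, f₄ : ℝ → ℂ be Schwartz functions such that for some indices i ≠ k in {1,2,3,4}, the supports of f_i and f_k are separated by a distance at least R > 0. Let p, p₁, p₂, p₃, p₄ ∈ [1,∞] satisfy 1/p = 1/p₁ + 1/p₂ + 1/p₃ + 1/p₄. Then ‖ f₄ · T_m(f₁, f₂, f₃) ‖_{L^p(ℝ)} ≤ C_N · A · (1 + 2^j R)^{-N} · ‖f₁‖_{L^{p₁}} ‖f₂‖_{L^{p₂}} ‖f₃‖_{L^{p₃}} ‖f₄‖_{L^{p₄}}. -/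

import Mathlib

open MeasureTheory Filter
open scoped ENNReal

noncomputable def fourierT (f : ℝ → ℂ) (ξ : ℝ) : ℂ :=
  (Real.sqrt (2 * Real.pi) : ℂ)⁻¹ * ∫ x : ℝ, f x * Complex.exp (-(Complex.I * x * ξ))

/-- The trilinear pseudoproduct operator `T_m`, defined by
`𝓕(T_m(f,g,h))(ξ) = (2π)⁻¹ ∬ m(ξ,η,σ) 𝓕f(η) 𝓕g(ξ−η−σ) 𝓕h(σ) dη dσ`. -/
noncomputable def pseudoProd (m : ℝ → ℝ → ℝ → ℂ) (f g h : ℝ → ℂ) (x : ℝ) : ℂ :=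
  (Real.sqrt (2 * Real.pi) : ℂ)⁻¹ *
    ∫ ξ : ℝ,
      (((2 * Real.pi : ℝ) : ℂ)⁻¹ *
        ∫ q : ℝ × ℝ, m ξ q.1 q.2 * fourierT f q.1 * fourierT g (ξ - q.1 - q.2)
          * fourierT h q.2) *
      Complex.exp (Complex.I * x * ξ)

/-- The inverse Fourier transform of a symbol on `ℝ³`:
`m̌(y,z,w) = (2π)^{-3/2} ∭ m(ξ,η,σ) e^{i(yξ+zη+wσ)} dξ dη dσ`. -/
noncomputable def invFT3 (m : ℝ → ℝ → ℝ → ℂ) (y : ℝ × ℝ × ℝ) : ℂ :=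
  ((Real.sqrt (2 * Real.pi) : ℂ)⁻¹) ^ 3 *
    ∫ q : ℝ × ℝ × ℝ, m q.1 q.2.1 q.2.2 *
      Complex.exp (Complex.I * ((y.1 * q.1 : ℝ) + y.2.1 * q.2.1 + y.2.2 * q.2.2))


theorem mink_aux {E : Type*} [MeasurableSpace E] (ν : Measure E) [IsFiniteMeasure ν]
    (Φ : ℝ → E → ℝ≥0∞) (hΦ : Measurable (Function.uncurry Φ)) (p : ℝ≥0∞) (hp : 1 ≤ p)
    (B : ℝ≥0∞) (hB : ∀ Y, eLpNorm (fun x => Φ x Y) p volume ≤ B) :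
    eLpNorm (fun x => ∫⁻ Y, Φ x Y ∂ν) p volume ≤ ν Set.univ * B := by
  have hm1 : ∀ x, Measurable (Φ x) := fun x => hΦ.comp measurable_prodMk_left
  have hm2 : ∀ Y, Measurable (fun x => Φ x Y) := fun Y => hΦ.comp measurable_prodMk_right
  by_cases hpt : p = ∞
  · subst hpt
    have h1 : ∀ᵐ x ∂(volume : Measure ℝ), ∀ᵐ Y ∂ν, Φ x Y ≤ B := by
      rw [Measure.ae_ae_comm]
      · refine Eventually.of_forall fun Y => ?_
        have := hB Y
        rw [eLpNorm_exponent_top] at this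
        filter_upwards [enorm_ae_le_eLpNormEssSup (fun x => Φ x Y) volume] with x hx
        exact (le_trans (by simp) hx).trans this
      · exact measurableSet_le hΦ measurable_const
    rw [eLpNorm_exponent_top]
    refine essSup_le_of_ae_le _ ?_
    filter_upwards [h1] with x hx
    calc ‖∫⁻ Y, Φ x Y ∂ν‖ₑ = ∫⁻ Y, Φ x Y ∂ν := by simp
      _ ≤ ∫⁻ Y, B ∂ν := lintegral_mono_ae hx
      _ = ν Set.univ * B := by simp [mul_comm]
  · set r := p.toReal with hr
    have hp0 : p ≠ 0 := (zero_lt_one.trans_le hp).ne'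
    have hr1 : 1 ≤ r := by
      rw [hr]; exact (ENNReal.toReal_mono hpt hp).trans_eq' (by simp)
    have hr0 : 0 < r := by linarith
    have key : ∀ x, (∫⁻ Y, Φ x Y ∂ν) ^ r ≤ (∫⁻ Y, Φ x Y ^ r ∂ν) * ν Set.univ ^ (r - 1) := by
      intro x
      have h := eLpNorm_le_eLpNorm_mul_rpow_measure_univ hp
        ((hm1 x).aestronglyMeasurable (μ := ν))
      rw [eLpNorm_one_eq_lintegral_enorm, eLpNorm_eq_lintegral_rpow_enorm_toReal hp0 hpt] at h
      simp only [enorm_eq_self, ENNReal.toReal_one, ← hr] at h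
      calc (∫⁻ Y, Φ x Y ∂ν) ^ r ≤ _ := ENNReal.rpow_le_rpow h hr0.le
        _ = _ := by
          rw [ENNReal.mul_rpow_of_nonneg _ _ hr0.le, ← ENNReal.rpow_mul, ← ENNReal.rpow_mul]
          congr 2
          · rw [one_div_mul_cancel hr0.ne', ENNReal.rpow_one]
          · field_simp
    have hB' : ∀ Y, ∫⁻ x, Φ x Y ^ r ≤ B ^ r := by
      intro Y
      have := hB Y
      rw [eLpNorm_eq_lintegral_rpow_enorm_toReal hp0 hpt] at this
      simp only [enorm_eq_self, ← hr] at this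
      rwa [one_div, ENNReal.rpow_inv_le_iff hr0] at this
    rw [eLpNorm_eq_lintegral_rpow_enorm_toReal hp0 hpt]
    simp only [enorm_eq_self, ← hr]
    rw [one_div, ENNReal.rpow_inv_le_iff hr0]
    calc ∫⁻ x, (∫⁻ Y, Φ x Y ∂ν) ^ r ≤ ∫⁻ x, (∫⁻ Y, Φ x Y ^ r ∂ν) * ν Set.univ ^ (r - 1) :=
          lintegral_mono key
      _ = (∫⁻ x, (∫⁻ Y, Φ x Y ^ r ∂ν)) * ν Set.univ ^ (r - 1) := by
          rw [lintegral_mul_const]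
          exact (hΦ.pow_const r).lintegral_prod_right'
      _ = (∫⁻ Y, (∫⁻ x, Φ x Y ^ r) ∂ν) * ν Set.univ ^ (r - 1) := by
          rw [lintegral_lintegral_swap]
          exact (hΦ.pow_const r).aemeasurable
      _ ≤ (∫⁻ Y, B ^ r ∂ν) * ν Set.univ ^ (r - 1) := by
          gcongr with Y; exact hB' Y
      _ = (ν Set.univ * B) ^ r := by
          rw [ENNReal.mul_rpow_of_nonneg _ _ hr0.le, lintegral_const]
          have : ν Set.univ ^ r = ν Set.univ * ν Set.univ ^ (r - 1) := by
            conv_rhs => enter [1]; rw [← ENNReal.rpow_one (ν Set.univ)]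
            rw [← ENNReal.rpow_add_of_nonneg _ _ zero_le_one (by linarith)]
            congr 1; ring
          rw [this]; ring

noncomputable def dot3 : (ℝ × ℝ × ℝ) →L[ℝ] (ℝ × ℝ × ℝ) →L[ℝ] ℝ :=
  (ContinuousLinearMap.mul ℝ ℝ).bilinearComp (ContinuousLinearMap.fst ℝ ℝ (ℝ × ℝ))
      (ContinuousLinearMap.fst ℝ ℝ (ℝ × ℝ)) +
  (ContinuousLinearMap.mul ℝ ℝ).bilinearComp
      ((ContinuousLinearMap.fst ℝ ℝ ℝ).comp (ContinuousLinearMap.snd ℝ ℝ (ℝ × ℝ)))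
      ((ContinuousLinearMap.fst ℝ ℝ ℝ).comp (ContinuousLinearMap.snd ℝ ℝ (ℝ × ℝ))) +
  (ContinuousLinearMap.mul ℝ ℝ).bilinearComp
      ((ContinuousLinearMap.snd ℝ ℝ ℝ).comp (ContinuousLinearMap.snd ℝ ℝ (ℝ × ℝ)))
      ((ContinuousLinearMap.snd ℝ ℝ ℝ).comp (ContinuousLinearMap.snd ℝ ℝ (ℝ × ℝ)))

theorem dot3_apply (a b : ℝ × ℝ × ℝ) :
    dot3 a b = a.1 * b.1 + a.2.1 * b.2.1 + a.2.2 * b.2.2 := by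
  simp [dot3]

theorem dot3_norming (Y : ℝ × ℝ × ℝ) : ∃ e : ℝ × ℝ × ℝ, ‖e‖ ≤ 1 ∧ |dot3 e Y| = ‖Y‖ := by
  obtain ⟨a, b, c⟩ := Y
  rcases le_total ‖a‖ (max ‖b‖ ‖c‖) with h | h
  · rcases le_total ‖b‖ ‖c‖ with h' | h'
    · refine ⟨(0, 0, 1), by simp [Prod.norm_def], ?_⟩
      rw [max_eq_right h'] at h
      simp only [dot3_apply, Prod.norm_def, max_eq_right h', max_eq_right h]
      simp
    · refine ⟨(0, 1, 0), by simp [Prod.norm_def], ?_⟩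
      rw [max_eq_left h'] at h
      simp only [dot3_apply, Prod.norm_def, max_eq_left h', max_eq_right h]
      simp
  · refine ⟨(1, 0, 0), by simp [Prod.norm_def], ?_⟩
    simp only [dot3_apply, Prod.norm_def, max_eq_left h]
    simp

noncomputable def kap (m : ℝ × ℝ × ℝ → ℂ) (Y : ℝ × ℝ × ℝ) : ℂ :=
  ∫ q : ℝ × ℝ × ℝ, m q * Complex.exp (Complex.I * ((dot3 q Y : ℝ) : ℂ))

theorem kap_eq (m : ℝ × ℝ × ℝ → ℂ) (Y : ℝ × ℝ × ℝ) :
    kap m Y = VectorFourier.fourierIntegral Real.fourierChar volume dot3.toLinearMap₁₂ m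
      ((-(2 * Real.pi)⁻¹ : ℝ) • Y) := by
  unfold kap VectorFourier.fourierIntegral
  congr 1
  ext q
  rw [Circle.smul_def, Real.fourierChar_apply, smul_eq_mul, mul_comm]
  congr 2
  simp only [ContinuousLinearMap.toLinearMap₁₂_apply, map_smul, smul_eq_mul]
  push_cast
  have : (Real.pi : ℂ) ≠ 0 := by exact_mod_cast Real.pi_ne_zero
  field_simp
  rfl

theorem haar3 : (volume : Measure (ℝ × ℝ × ℝ)).IsAddHaarMeasure := by
  have h2 : (volume : Measure (ℝ × ℝ)).IsAddHaarMeasure :=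
    inferInstanceAs ((volume : Measure ℝ).prod (volume : Measure ℝ)).IsAddHaarMeasure
  exact inferInstanceAs ((volume : Measure ℝ).prod (volume : Measure (ℝ × ℝ))).IsAddHaarMeasure

theorem vol_ball3 (r : ℝ) (hr : 0 ≤ r) :
    (volume : Measure (ℝ × ℝ × ℝ)).real (Metric.closedBall 0 r) = (2 * r) ^ 3 := by
  have : Metric.closedBall (0 : ℝ × ℝ × ℝ) r =
      Metric.closedBall 0 r ×ˢ (Metric.closedBall 0 r ×ˢ Metric.closedBall 0 r) := by
    rw [closedBall_prod_same, closedBall_prod_same]; rfl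
  rw [this, measureReal_def, Measure.volume_eq_prod, Measure.prod_prod, Measure.volume_eq_prod,
    Measure.prod_prod]
  simp only [Real.volume_closedBall, ENNReal.toReal_mul]
  rw [ENNReal.toReal_ofReal (by positivity)]
  ring

theorem kap_bound_n (M : ℕ) (s A : ℝ) (hs : 0 < s) (m : ℝ × ℝ × ℝ → ℂ)
    (hm : ContDiff ℝ (M : ℕ∞) m)
    (hsupp : Function.support m ⊆ Metric.closedBall 0 (32 * s))
    (hD : ∀ n ≤ M, ∀ q, ‖iteratedFDeriv ℝ n m q‖ ≤ A * (s ^ n)⁻¹) (Y : ℝ × ℝ × ℝ)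
    (n : ℕ) (hn : n ≤ M) :
    (s * ‖Y‖) ^ n * ‖kap m Y‖ ≤ A * (64 * s) ^ 3 := by
  have htsupp : tsupport m ⊆ Metric.closedBall 0 (32 * s) :=
    closure_minimal hsupp Metric.isClosed_closedBall
  have hcs : HasCompactSupport m :=
    (isCompact_closedBall _ _).of_isClosed_subset (isClosed_tsupport m) htsupp
  have hint : ∀ k : ℕ, (k : ℕ∞) ≤ (M : ℕ∞) → Integrable (iteratedFDeriv ℝ k m) volume := by
    intro k hk
    refine Continuous.integrable_of_hasCompactSupport ?_ (hcs.iteratedFDeriv k)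
    exact hm.continuous_iteratedFDeriv (by exact_mod_cast hk)
  have hI : ∫ q, ‖iteratedFDeriv ℝ n m q‖ ≤ A * (s ^ n)⁻¹ * (64 * s) ^ 3 := by
    have h0 : ∫ q, ‖iteratedFDeriv ℝ n m q‖ =
        ∫ q in Metric.closedBall 0 (32 * s), ‖iteratedFDeriv ℝ n m q‖ := by
      rw [setIntegral_eq_integral_of_forall_compl_eq_zero]
      intro q hq
      rw [norm_eq_zero]
      by_contra h
      exact hq (htsupp (support_iteratedFDeriv_subset n h))
    rw [h0]
    have h1 := norm_setIntegral_le_of_norm_le_const (μ := volume)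
      (s := Metric.closedBall (0 : ℝ × ℝ × ℝ) (32 * s))
      (f := fun q => ‖iteratedFDeriv ℝ n m q‖) (C := A * (s ^ n)⁻¹)
      (isCompact_closedBall _ _).measure_lt_top
      (fun q _ => by rw [norm_norm]; exact hD n hn q)
    rw [vol_ball3 _ (by positivity)] at h1
    refine (le_abs_self _).trans (h1.trans (le_of_eq (by ring)))
  obtain ⟨e, he, heY⟩ := dot3_norming Y
  have := haar3
  have h2 := VectorFourier.fourierIntegral_iteratedFDeriv dot3 (μ := volume) hm hint
    (n := n) (by exact_mod_cast hn)
  have h3 := congrFun h2 ((-(2 * Real.pi)⁻¹ : ℝ) • Y)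
  have h4 := congrArg (fun T => T (fun _ => e)) h3
  simp only [VectorFourier.fourierPowSMulRight_apply, ← kap_eq] at h4
  have h5 := congrArg norm h4
  have h6 : ‖VectorFourier.fourierIntegral Real.fourierChar volume dot3.toLinearMap₁₂
      (iteratedFDeriv ℝ n m) ((-(2 * Real.pi)⁻¹ : ℝ) • Y)‖ ≤ A * (s ^ n)⁻¹ * (64 * s) ^ 3 :=
    (VectorFourier.norm_fourierIntegral_le_integral_norm _ _ _ _ _).trans hI
  have h7 : ‖Y‖ ^ n * ‖kap m Y‖ ≤ A * (s ^ n)⁻¹ * (64 * s) ^ 3 := by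
    refine le_trans (le_of_eq ?_) ((h5.symm.le.trans
      (ContinuousMultilinearMap.le_opNorm _ _)).trans ?_)
    · simp only [norm_smul, Finset.prod_const, norm_pow, Finset.card_univ, Fintype.card_fin]
      rw [← mul_assoc, ← mul_pow]
      congr 2
      rw [← heY]
      have := Real.pi_pos
      simp [abs_of_pos this]
      field_simp
    · calc _ ≤ (A * (s ^ n)⁻¹ * (64 * s) ^ 3) * 1 := by
            refine mul_le_mul h6 ?_ (by positivity) ((norm_nonneg _).trans h6)
            exact Finset.prod_le_one (fun _ _ => norm_nonneg _) (fun _ _ => he)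
        _ = _ := mul_one _
  calc (s * ‖Y‖) ^ n * ‖kap m Y‖ = s ^ n * (‖Y‖ ^ n * ‖kap m Y‖) := by ring
    _ ≤ s ^ n * (A * (s ^ n)⁻¹ * (64 * s) ^ 3) := by gcongr
    _ = _ := by field_simp

theorem kap_bound (M : ℕ) (s A : ℝ) (hs : 0 < s) (m : ℝ × ℝ × ℝ → ℂ)
    (hm : ContDiff ℝ (M : ℕ∞) m)
    (hsupp : Function.support m ⊆ Metric.closedBall 0 (32 * s))
    (hD : ∀ n ≤ M, ∀ q, ‖iteratedFDeriv ℝ n m q‖ ≤ A * (s ^ n)⁻¹) (Y : ℝ × ℝ × ℝ) :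
    ‖kap m Y‖ ≤ 2 ^ M * (2 * (A * (64 * s) ^ 3)) * ((1 + s * ‖Y‖) ^ M)⁻¹ := by
  have h0 := kap_bound_n M s A hs m hm hsupp hD Y 0 (Nat.zero_le _)
  have h1 := kap_bound_n M s A hs m hm hsupp hD Y M le_rfl
  have h2 : (1 + s * ‖Y‖) ^ M ≤ 2 ^ M * (1 + (s * ‖Y‖) ^ M) := by
    have := add_pow_le (zero_le_one' ℝ) (by positivity : 0 ≤ s * ‖Y‖) M
    rw [one_pow] at this
    refine this.trans ?_
    gcongr
    · norm_num
    · omega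
  rw [← div_eq_mul_inv, le_div_iff₀ (by positivity)]
  calc ‖kap m Y‖ * (1 + s * ‖Y‖) ^ M ≤ ‖kap m Y‖ * (2 ^ M * (1 + (s * ‖Y‖) ^ M)) := by gcongr
    _ = 2 ^ M * ((s * ‖Y‖) ^ 0 * ‖kap m Y‖ + (s * ‖Y‖) ^ M * ‖kap m Y‖) := by ring
    _ ≤ _ := by gcongr; linarith

theorem kap_measurable (m : ℝ × ℝ × ℝ → ℂ) (hm : Continuous m) : Measurable (kap m) := by
  unfold kap
  refine StronglyMeasurable.measurable ?_
  refine StronglyMeasurable.integral_prod_right'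
    (f := fun z : (ℝ × ℝ × ℝ) × (ℝ × ℝ × ℝ) =>
      m z.2 * Complex.exp (Complex.I * ((dot3 z.2 z.1 : ℝ) : ℂ))) ?_
  refine Continuous.stronglyMeasurable ?_
  simp only [dot3_apply]
  fun_prop

theorem pseudoProd_eq (m : ℝ → ℝ → ℝ → ℂ)
    (hmc : Continuous (fun q : ℝ × ℝ × ℝ => m q.1 q.2.1 q.2.2))
    (hmi : Integrable (fun q : ℝ × ℝ × ℝ => m q.1 q.2.1 q.2.2))
    (f₁ f₂ f₃ : SchwartzMap ℝ ℂ) (x : ℝ) :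
    pseudoProd m f₁ f₂ f₃ x =
      ((Real.sqrt (2 * Real.pi) : ℂ)⁻¹ ^ 4 * ((2 * Real.pi : ℝ) : ℂ)⁻¹) *
      ∫ P : ℝ × ℝ × ℝ, (f₂ P.1 * (f₁ P.2.1 * f₃ P.2.2)) *
        kap (fun q : ℝ × ℝ × ℝ => m q.1 q.2.1 q.2.2) (x - P.1, P.1 - P.2.1, P.1 - P.2.2) := by
  set H : (ℝ × ℝ × ℝ) → (ℝ × ℝ × ℝ) → ℂ := fun Q P =>
    Complex.exp (Complex.I * ((dot3 Q (x - P.1, P.1 - P.2.1, P.1 - P.2.2) : ℝ) : ℂ)) *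
      (m Q.1 Q.2.1 Q.2.2 * (f₂ P.1 * (f₁ P.2.1 * f₃ P.2.2))) with hH
  have hf : Integrable (fun P : ℝ × ℝ × ℝ => f₂ P.1 * (f₁ P.2.1 * f₃ P.2.2)) :=
    f₂.integrable.mul_prod (f₁.integrable.mul_prod f₃.integrable)
  have hHi : Integrable (Function.uncurry H) (volume.prod volume) := by
    refine Integrable.bdd_mul (c := 1) (hmi.mul_prod hf) ?_ ?_
    · refine Continuous.aestronglyMeasurable ?_
      simp only [dot3_apply]
      fun_prop
    · refine Eventually.of_forall fun z => ?_
      rw [mul_comm, Complex.norm_exp_ofReal_mul_I]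
  have h1 : ∫ P : ℝ × ℝ × ℝ, (f₂ P.1 * (f₁ P.2.1 * f₃ P.2.2)) *
        kap (fun q : ℝ × ℝ × ℝ => m q.1 q.2.1 q.2.2) (x - P.1, P.1 - P.2.1, P.1 - P.2.2)
      = ∫ P, ∫ Q, H Q P := by
    congr 1
    ext P
    unfold kap
    rw [← integral_const_mul]
    congr 1
    ext Q
    simp only [hH]
    ring
  have h2 : ∀ Q : ℝ × ℝ × ℝ, ∫ P, H Q P = m Q.1 Q.2.1 Q.2.2 * Complex.exp (Complex.I * x * Q.1) *
      ((∫ v : ℝ, f₂ v * Complex.exp (-(Complex.I * v * (Q.1 - Q.2.1 - Q.2.2 : ℝ)))) *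
      ((∫ u : ℝ, f₁ u * Complex.exp (-(Complex.I * u * Q.2.1))) *
      (∫ w : ℝ, f₃ w * Complex.exp (-(Complex.I * w * Q.2.2))))) := by
    intro Q
    rw [← integral_prod_mul, ← integral_prod_mul, ← integral_const_mul]
    congr 1
    ext P
    simp only [hH, dot3_apply]
    have : Complex.exp (Complex.I * ((Q.1 * (x - P.1) + Q.2.1 * (P.1 - P.2.1)
          + Q.2.2 * (P.1 - P.2.2) : ℝ) : ℂ))
        = Complex.exp (Complex.I * x * Q.1) *
          (Complex.exp (-(Complex.I * P.1 * (Q.1 - Q.2.1 - Q.2.2 : ℝ))) *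
          (Complex.exp (-(Complex.I * P.2.1 * Q.2.1)) *
            Complex.exp (-(Complex.I * P.2.2 * Q.2.2)))) := by
      rw [← Complex.exp_add, ← Complex.exp_add, ← Complex.exp_add]
      congr 1
      push_cast
      ring
    rw [this]
    ring
  rw [h1, ← integral_integral_swap hHi]
  have h3 : ∫ Q, ∫ P, H Q P = ∫ ξ : ℝ, ∫ q : ℝ × ℝ, ∫ P, H (ξ, q) P := by
    rw [Measure.volume_eq_prod, integral_prod]
    exact hHi.integral_prod_left
  rw [h3]
  unfold pseudoProd
  rw [← integral_const_mul, ← integral_const_mul]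
  congr 1
  ext ξ
  rw [← integral_const_mul, ← integral_const_mul, ← integral_mul_const, ← integral_const_mul]
  congr 1
  ext q
  rw [h2]
  simp only [fourierT]
  ring

theorem pseudoProd_enorm_le (m : ℝ → ℝ → ℝ → ℂ)
    (hmc : Continuous (fun q : ℝ × ℝ × ℝ => m q.1 q.2.1 q.2.2))
    (hmi : Integrable (fun q : ℝ × ℝ × ℝ => m q.1 q.2.1 q.2.2))
    (f₁ f₂ f₃ : SchwartzMap ℝ ℂ) (x : ℝ) :
    ‖pseudoProd m f₁ f₂ f₃ x‖ₑ ≤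
      ∫⁻ Y : ℝ × ℝ × ℝ, ‖f₂ (x - Y.1) * (f₁ (x - Y.1 - Y.2.1) * f₃ (x - Y.1 - Y.2.2))‖ₑ *
        ‖kap (fun q : ℝ × ℝ × ℝ => m q.1 q.2.1 q.2.2) Y‖ₑ := by
  have hk := kap_measurable _ hmc
  rw [pseudoProd_eq m hmc hmi, enorm_mul]
  have hc : ‖((Real.sqrt (2 * Real.pi) : ℂ)⁻¹ ^ 4 * ((2 * Real.pi : ℝ) : ℂ)⁻¹)‖ₑ ≤ 1 := by
    rw [← ofReal_norm, ENNReal.ofReal_le_one]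
    have h1 : 1 ≤ 2 * Real.pi := by linarith [Real.pi_gt_three]
    have h2 : 1 ≤ Real.sqrt (2 * Real.pi) := by rw [Real.one_le_sqrt]; exact h1
    rw [norm_mul, norm_pow, norm_inv, norm_inv, Complex.norm_real, Complex.norm_real,
      Real.norm_of_nonneg (by positivity), Real.norm_of_nonneg (by positivity)]
    exact mul_le_one₀ (pow_le_one₀ (by positivity) (inv_le_one_of_one_le₀ h2)) (by positivity)
      (inv_le_one_of_one_le₀ h1)
  refine (mul_le_mul_left hc _).trans ?_
  rw [one_mul]
  refine (enorm_integral_le_lintegral_enorm _).trans (le_of_eq ?_)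
  set k := kap (fun q : ℝ × ℝ × ℝ => m q.1 q.2.1 q.2.2) with hkdef
  have c1 := f₁.continuous.measurable
  have c2 := f₂.continuous.measurable
  have c3 := f₃.continuous.measurable
  simp only [enorm_mul]
  set G : ℝ → ℝ → ℝ → ℝ≥0∞ := fun v u w => ‖f₂ v‖ₑ * (‖f₁ u‖ₑ * ‖f₃ w‖ₑ) *
    ‖k (x - v, v - u, v - w)‖ₑ with hG
  have e1 : ∫⁻ P : ℝ × ℝ × ℝ, G P.1 P.2.1 P.2.2 = ∫⁻ v, ∫⁻ u, ∫⁻ w, G v u w := by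
    rw [Measure.volume_eq_prod, lintegral_prod _ (by fun_prop)]
    congr 1
    ext v
    rw [Measure.volume_eq_prod, lintegral_prod _ (by fun_prop)]
  have e2 : ∫⁻ v, ∫⁻ u, ∫⁻ w, G v u w =
      ∫⁻ a, ∫⁻ b, ∫⁻ c, G (x - a) (x - a - b) (x - a - c) := by
    rw [← lintegral_sub_left_eq_self _ x]
    congr 1
    ext a
    rw [← lintegral_sub_left_eq_self _ (x - a)]
    congr 1
    ext b
    rw [← lintegral_sub_left_eq_self _ (x - a)]
  have e3 : ∫⁻ Y : ℝ × ℝ × ℝ, G (x - Y.1) (x - Y.1 - Y.2.1) (x - Y.1 - Y.2.2) =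
      ∫⁻ a, ∫⁻ b, ∫⁻ c, G (x - a) (x - a - b) (x - a - c) := by
    rw [Measure.volume_eq_prod, lintegral_prod _ (by fun_prop)]
    congr 1
    ext v
    rw [Measure.volume_eq_prod, lintegral_prod _ (by fun_prop)]
  refine (e1.trans (e2.trans e3.symm)).trans ?_
  congr 1
  ext Y
  simp only [hG]
  congr 3
  ext <;> simp

theorem sep_aux (f₁ f₂ f₃ f₄ : SchwartzMap ℝ ℂ) (R : ℝ)
    (h : ∃ i k : Fin 4, i ≠ k ∧
        ∀ x ∈ Function.support (![⇑f₁, ⇑f₂, ⇑f₃, ⇑f₄] i),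
        ∀ y ∈ Function.support (![⇑f₁, ⇑f₂, ⇑f₃, ⇑f₄] k), R ≤ |x - y|)
    (x : ℝ) (Y : ℝ × ℝ × ℝ) (h4 : f₄ x ≠ 0) (h2 : f₂ (x - Y.1) ≠ 0)
    (h1 : f₁ (x - Y.1 - Y.2.1) ≠ 0) (h3 : f₃ (x - Y.1 - Y.2.2) ≠ 0) : R ≤ 2 * ‖Y‖ := by
  obtain ⟨i, k, hik, h⟩ := h
  obtain ⟨a, b, c⟩ := Y
  simp only at h1 h2 h3
  have hn : ∃ n, n = ‖(a, b, c)‖ := ⟨_, rfl⟩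
  obtain ⟨n, hn⟩ := hn
  rw [← hn]
  have ha : |a| ≤ n := by rw [hn]; simp [Prod.norm_def]
  have hb : |b| ≤ n := by rw [hn]; simp [Prod.norm_def]
  have hc : |c| ≤ n := by rw [hn]; simp [Prod.norm_def]
  have key : ∀ i : Fin 4, ![x - a - b, x - a, x - a - c, x] i ∈
      Function.support (![⇑f₁, ⇑f₂, ⇑f₃, ⇑f₄] i) := by
    intro i
    fin_cases i
    · exact h1
    · exact h2
    · exact h3
    · exact h4
  refine (h _ (key i) _ (key k)).trans ?_
  rw [abs_le] at *
  clear h key h1 h2 h3 h4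
  fin_cases i <;> fin_cases k <;> simp at hik ⊢ <;> constructor <;> linarith [ha.1, ha.2, hb.1, hb.2, hc.1, hc.2]

theorem holder4 (g₁ g₂ g₃ g₄ : ℝ → ℂ) (c1 : Continuous g₁) (c2 : Continuous g₂)
    (c3 : Continuous g₃) (c4 : Continuous g₄) (p p₁ p₂ p₃ p₄ : ℝ≥0∞)
    (hp : p⁻¹ = p₁⁻¹ + p₂⁻¹ + p₃⁻¹ + p₄⁻¹) :
    eLpNorm (fun x => g₄ x * (g₂ x * (g₁ x * g₃ x))) p volume ≤
      eLpNorm g₁ p₁ volume * eLpNorm g₂ p₂ volume * eLpNorm g₃ p₃ volume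
        * eLpNorm g₄ p₄ volume := by
  have i1 : ENNReal.HolderTriple p₁ p₃ (p₁⁻¹ + p₃⁻¹)⁻¹ := ⟨by simp⟩
  have i2 : ENNReal.HolderTriple p₂ (p₁⁻¹ + p₃⁻¹)⁻¹ (p₂⁻¹ + (p₁⁻¹ + p₃⁻¹))⁻¹ := ⟨by simp⟩
  have i3 : ENNReal.HolderTriple p₄ (p₂⁻¹ + (p₁⁻¹ + p₃⁻¹))⁻¹ p := ⟨by
    rw [hp, inv_inv]; ring⟩
  have b1 : eLpNorm (g₁ • g₃) (p₁⁻¹ + p₃⁻¹)⁻¹ volume ≤ _ :=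
    eLpNorm_smul_le_mul_eLpNorm (p := p₁) (q := p₃) c3.aestronglyMeasurable c1.aestronglyMeasurable
  have b2 : eLpNorm (g₂ • (g₁ • g₃)) (p₂⁻¹ + (p₁⁻¹ + p₃⁻¹))⁻¹ volume ≤ _ :=
    eLpNorm_smul_le_mul_eLpNorm (p := p₂) (q := (p₁⁻¹ + p₃⁻¹)⁻¹)
      (c1.smul c3).aestronglyMeasurable c2.aestronglyMeasurable
  have b3 : eLpNorm (g₄ • (g₂ • (g₁ • g₃))) p volume ≤ _ :=
    eLpNorm_smul_le_mul_eLpNorm (p := p₄) (q := (p₂⁻¹ + (p₁⁻¹ + p₃⁻¹))⁻¹)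
      (c2.smul (c1.smul c3)).aestronglyMeasurable c4.aestronglyMeasurable
  calc _ ≤ _ := b3
    _ ≤ eLpNorm g₄ p₄ volume * (eLpNorm g₂ p₂ volume *
        (eLpNorm g₁ p₁ volume * eLpNorm g₃ p₃ volume)) := by
      refine mul_le_mul_right (b2.trans (mul_le_mul_right b1 _)) _
    _ = _ := by ring

theorem eLpNorm_translate (f : SchwartzMap ℝ ℂ) (p : ℝ≥0∞) (a : ℝ) :
    eLpNorm (fun x => f (x - a)) p volume = eLpNorm (f : ℝ → ℂ) p volume :=
  eLpNorm_comp_measurePreserving f.continuous.aestronglyMeasurable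
    (measurePreserving_sub_right volume a)

theorem weight_fin : (∫⁻ Y : ℝ × ℝ × ℝ, ENNReal.ofReal (((1 + ‖Y‖) ^ 4)⁻¹)) < ∞ := by
  have := haar3
  have h := finite_integral_one_add_norm (μ := (volume : Measure (ℝ × ℝ × ℝ))) (r := 4)
    (by simp; norm_num)
  refine lt_of_eq_of_lt ?_ h
  congr 1
  ext Y
  rw [Real.rpow_neg (by positivity)]
  norm_cast

theorem weight_scale (s : ℝ) (hs : 0 < s) :
    (∫⁻ Y : ℝ × ℝ × ℝ, ENNReal.ofReal (s ^ 3 * ((1 + s * ‖Y‖) ^ 4)⁻¹)) =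
      ∫⁻ Y : ℝ × ℝ × ℝ, ENNReal.ofReal (((1 + ‖Y‖) ^ 4)⁻¹) := by
  have := haar3
  have hmeas : Measurable (fun Y : ℝ × ℝ × ℝ => ENNReal.ofReal (((1 + ‖Y‖) ^ 4)⁻¹)) := by
    fun_prop
  have h1 := lintegral_map (μ := (volume : Measure (ℝ × ℝ × ℝ))) hmeas
    (measurable_const_smul s)
  rw [Measure.map_addHaar_smul _ hs.ne', lintegral_smul_measure] at h1
  have h2 : (∫⁻ Y : ℝ × ℝ × ℝ, ENNReal.ofReal (s ^ 3 * ((1 + s * ‖Y‖) ^ 4)⁻¹)) =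
      ENNReal.ofReal (s ^ 3) * ∫⁻ Y : ℝ × ℝ × ℝ, ENNReal.ofReal (((1 + ‖s • Y‖) ^ 4)⁻¹) := by
    rw [← lintegral_const_mul _ (by fun_prop)]
    congr 1
    ext Y
    rw [ENNReal.ofReal_mul (by positivity), norm_smul, Real.norm_of_nonneg hs.le]
  rw [h2, ← h1, smul_eq_mul, ← mul_assoc, ← ENNReal.ofReal_mul (by positivity)]
  have h3 : Module.finrank ℝ (ℝ × ℝ × ℝ) = 3 := by simp
  rw [h3, abs_of_pos (by positivity), mul_inv_cancel₀ (by positivity)]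
  simp

/-- Pseudolocality of frequency-localized pseudoproducts: if two of the inputs
(among `f₁,f₂,f₃,f₄`) have supports separated by distance `R`, then
`f₄ · T_m(f₁,f₂,f₃)` is small, with a gain `(1 + 2^j R)^{-N}`. -/
theorem pseudoProd_pseudolocality : ∀ N : ℕ, ∃ K : ℕ, ∃ C > (0:ℝ),
    ∀ (j : ℤ) (A R : ℝ), 0 < A → 0 < R →
    ∀ m : ℝ → ℝ → ℝ → ℂ,
      ContDiff ℝ (K : ℕ∞) (fun q : ℝ × ℝ × ℝ => m q.1 q.2.1 q.2.2) →
      (Function.support (fun q : ℝ × ℝ × ℝ => m q.1 q.2.1 q.2.2) ⊆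
        {q : ℝ × ℝ × ℝ | |q.1| + |q.2.1| + |q.2.2| ≤ (2:ℝ) ^ (j + 5)}) →
      (∀ n : ℕ, n ≤ K → ∀ q : ℝ × ℝ × ℝ,
        ‖iteratedFDeriv ℝ n (fun q : ℝ × ℝ × ℝ => m q.1 q.2.1 q.2.2) q‖
          ≤ A * (2:ℝ) ^ (-(j * (n : ℤ)))) →
    ∀ f₁ f₂ f₃ f₄ : SchwartzMap ℝ ℂ,
      (∃ i k : Fin 4, i ≠ k ∧
        ∀ x ∈ Function.support (![⇑f₁, ⇑f₂, ⇑f₃, ⇑f₄] i),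
        ∀ y ∈ Function.support (![⇑f₁, ⇑f₂, ⇑f₃, ⇑f₄] k), R ≤ |x - y|) →
    ∀ p p₁ p₂ p₃ p₄ : ℝ≥0∞, 1 ≤ p → 1 ≤ p₁ → 1 ≤ p₂ → 1 ≤ p₃ → 1 ≤ p₄ →
      p⁻¹ = p₁⁻¹ + p₂⁻¹ + p₃⁻¹ + p₄⁻¹ →
      eLpNorm (fun x : ℝ => f₄ x * pseudoProd m f₁ f₂ f₃ x) p volume
        ≤ ENNReal.ofReal (C * A * ((1 + (2:ℝ) ^ j * R) ^ N)⁻¹)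
          * eLpNorm (f₁ : ℝ → ℂ) p₁ volume * eLpNorm (f₂ : ℝ → ℂ) p₂ volume
          * eLpNorm (f₃ : ℝ → ℂ) p₃ volume * eLpNorm (f₄ : ℝ → ℂ) p₄ volume := by
  intro N
  set D : ℝ := (∫⁻ Y : ℝ × ℝ × ℝ, ENNReal.ofReal (((1 + ‖Y‖) ^ 4)⁻¹)).toReal with hDdef
  have hD0 : 0 ≤ D := ENNReal.toReal_nonneg
  set C₀ : ℝ := 2 ^ (N + 4) * 2 * 64 ^ 3 * 2 ^ N with hC₀
  have hC₀pos : 0 < C₀ := by positivity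
  refine ⟨N + 4, C₀ * (D + 1), by positivity, ?_⟩
  intro j A R hA hR m hm hsupp hder f₁ f₂ f₃ f₄ hsep p p₁ p₂ p₃ p₄ hp _ _ _ _ hpp
  set s : ℝ := (2 : ℝ) ^ j with hs_def
  have hs : 0 < s := by positivity
  set m' : ℝ × ℝ × ℝ → ℂ := fun q => m q.1 q.2.1 q.2.2 with hm'
  have hmc : Continuous m' := hm.continuous
  have hsupp' : Function.support m' ⊆ Metric.closedBall 0 (32 * s) := by
    refine hsupp.trans ?_
    rintro ⟨a, b, c⟩ hq
    simp only [Set.mem_setOf_eq] at hq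
    have h32 : (2 : ℝ) ^ (j + 5) = 32 * s := by
      rw [zpow_add₀ two_ne_zero, hs_def, mul_comm]; norm_num
    rw [h32] at hq
    have := abs_nonneg a
    have := abs_nonneg b
    have := abs_nonneg c
    simp only [mem_closedBall_zero_iff, Prod.norm_def, Real.norm_eq_abs, sup_le_iff]
    exact ⟨by linarith, by linarith, by linarith⟩
  have hcs : HasCompactSupport m' :=
    (isCompact_closedBall _ _).of_isClosed_subset (isClosed_tsupport m')
      (closure_minimal hsupp' Metric.isClosed_closedBall)
  have hmi : Integrable m' := hmc.integrable_of_hasCompactSupport hcs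
  have hder' : ∀ n ≤ N + 4, ∀ q, ‖iteratedFDeriv ℝ n m' q‖ ≤ A * (s ^ n)⁻¹ := by
    intro n hn q
    have := hder n hn q
    rwa [zpow_neg, zpow_mul, zpow_natCast] at this
  have hk : ∀ Y, ‖kap m' Y‖ ≤
      2 ^ (N + 4) * (2 * (A * (64 * s) ^ 3)) * ((1 + s * ‖Y‖) ^ (N + 4))⁻¹ :=
    kap_bound (N + 4) s A hs m' hm hsupp' hder'
  set c : ℝ := C₀ * A * ((1 + s * R) ^ N)⁻¹ with hc
  have hc0 : 0 ≤ c := by positivity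
  set w : ℝ × ℝ × ℝ → ℝ≥0∞ := fun Y =>
    ENNReal.ofReal c * ENNReal.ofReal (s ^ 3 * ((1 + s * ‖Y‖) ^ 4)⁻¹) with hw
  have hwm : Measurable w := by fun_prop
  have hk2 : ∀ Y, R ≤ 2 * ‖Y‖ → ‖kap m' Y‖ₑ ≤ w Y := by
    intro Y hY
    simp only [hw]
    rw [← ENNReal.ofReal_mul hc0, ← ofReal_norm]
    refine ENNReal.ofReal_le_ofReal ((hk Y).trans ?_)
    have h1 : 1 + s * R ≤ 2 * (1 + s * ‖Y‖) := by nlinarith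
    have h2 : ((1 + s * ‖Y‖) ^ N)⁻¹ ≤ 2 ^ N * ((1 + s * R) ^ N)⁻¹ := by
      rw [← div_eq_mul_inv, le_div_iff₀ (by positivity), inv_mul_le_iff₀ (by positivity),
        ← mul_pow]
      refine pow_le_pow_left₀ (by positivity) ?_ N
      linarith
    calc _ = (2 ^ (N + 4) * 2 * 64 ^ 3 * A * (s ^ 3 * ((1 + s * ‖Y‖) ^ 4)⁻¹)) *
          ((1 + s * ‖Y‖) ^ N)⁻¹ := by rw [pow_add (1 + s * ‖Y‖), mul_inv]; ring
      _ ≤ (2 ^ (N + 4) * 2 * 64 ^ 3 * A * (s ^ 3 * ((1 + s * ‖Y‖) ^ 4)⁻¹)) *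
          (2 ^ N * ((1 + s * R) ^ N)⁻¹) := by gcongr
      _ = _ := by rw [hc, hC₀]; ring
  have hwint : ∫⁻ Y, w Y = ENNReal.ofReal (c * D) := by
    simp only [hw]
    rw [lintegral_const_mul _ (by fun_prop), weight_scale s hs, ENNReal.ofReal_mul hc0, hDdef,
      ENNReal.ofReal_toReal weight_fin.ne]
  set ν : Measure (ℝ × ℝ × ℝ) := volume.withDensity w with hν
  have hνuniv : ν Set.univ = ENNReal.ofReal (c * D) := by
    rw [hν, withDensity_apply _ MeasurableSet.univ, Measure.restrict_univ, hwint]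
  have hνfin : IsFiniteMeasure ν := ⟨by rw [hνuniv]; exact ENNReal.ofReal_lt_top⟩
  set Φ : ℝ → ℝ × ℝ × ℝ → ℝ≥0∞ := fun x Y =>
    ‖f₄ x * (f₂ (x - Y.1) * (f₁ (x - Y.1 - Y.2.1) * f₃ (x - Y.1 - Y.2.2)))‖ₑ with hΦ
  have c1 := f₁.continuous
  have c2 := f₂.continuous
  have c3 := f₃.continuous
  have c4 := f₄.continuous
  have hΦm : Measurable (Function.uncurry Φ) := by
    refine Continuous.measurable ?_
    simp only [hΦ, Function.uncurry_def]
    fun_prop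
  have hpt : ∀ x, ‖f₄ x * pseudoProd m f₁ f₂ f₃ x‖ₑ ≤ ∫⁻ Y, Φ x Y ∂ν := by
    intro x
    rw [enorm_mul]
    refine (mul_le_mul_right (pseudoProd_enorm_le m hmc hmi f₁ f₂ f₃ x) _).trans ?_
    have hΦx : Measurable (Φ x) := hΦm.comp measurable_prodMk_left
    rw [← lintegral_const_mul' _ _ enorm_ne_top, hν,
      lintegral_withDensity_eq_lintegral_mul _ hwm hΦx]
    refine lintegral_mono fun Y => ?_
    simp only [Pi.mul_apply]
    rw [← mul_assoc, ← enorm_mul, mul_comm (w Y)]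
    by_cases h : f₄ x * (f₂ (x - Y.1) * (f₁ (x - Y.1 - Y.2.1) * f₃ (x - Y.1 - Y.2.2))) = 0
    · rw [h]; simp
    · have h' := h
      simp only [mul_eq_zero, not_or] at h'
      exact mul_le_mul_right
        (hk2 Y (sep_aux f₁ f₂ f₃ f₄ R hsep x Y h'.1 h'.2.1 h'.2.2.1 h'.2.2.2)) _
  have hB : ∀ Y, eLpNorm (fun x => Φ x Y) p volume ≤
      eLpNorm (f₁ : ℝ → ℂ) p₁ volume * eLpNorm (f₂ : ℝ → ℂ) p₂ volume
          * eLpNorm (f₃ : ℝ → ℂ) p₃ volume * eLpNorm (f₄ : ℝ → ℂ) p₄ volume := by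
    intro Y
    simp only [hΦ, sub_sub]
    rw [eLpNorm_enorm]
    refine (holder4 (fun x => f₁ (x - (Y.1 + Y.2.1))) (fun x => f₂ (x - Y.1))
      (fun x => f₃ (x - (Y.1 + Y.2.2))) f₄ (by fun_prop) (by fun_prop) (by fun_prop) c4
      p p₁ p₂ p₃ p₄ hpp).trans ?_
    rw [eLpNorm_translate, eLpNorm_translate, eLpNorm_translate]
  calc _ ≤ eLpNorm (fun x => ∫⁻ Y, Φ x Y ∂ν) p volume :=
        eLpNorm_mono_enorm fun x => by rw [enorm_eq_self]; exact hpt x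
    _ ≤ _ := mink_aux ν Φ hΦm p hp _ hB
    _ ≤ ENNReal.ofReal (C₀ * (D + 1) * A * ((1 + s * R) ^ N)⁻¹) * _ := by
        rw [hνuniv]
        refine mul_le_mul_left (ENNReal.ofReal_le_ofReal ?_) _
        calc c * D ≤ c * (D + 1) := by gcongr; linarith
          _ = _ := by rw [hc]; ring
    _ = _ := by ring
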